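/- Let J be a reduced Albert algebra over a field F of characteristic not 2 or 3, and let j, j' ∈ J with j ≠ 0 and j^# = (j')^# = 0. Then the following are equivalent: (1) j' ∈ j×J := {j×k : k ∈ J}; (2) ⟨j,j'⟩ = 0 in End_F(J); (3) the image of ⟨j,j'⟩ is contained in F·j. -/

import Mathlib

set_option synthInstance.maxHeartbeats 1000000
set_option maxHeartbeats 1000000

noncomputable section

open scoped TensorProduct

universe u v

structure OctonionAlgebra (F : Type u) [Field F] : Type (max u (v + 1)) where
  C : Type v
  [ringC : NonAssocRing C]
  [modC : Module F C]
  [sccC : SMulCommClass F C C]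
  [istC : IsScalarTower F C C]
  n : QuadraticForm F C
  finrank_eq : Module.finrank F C = 8
  nondeg : ∀ x : C, (∀ y : C, QuadraticMap.polar (⇑n) x y = 0) → x = 0
  n_one : n 1 = 1
  n_mul : ∀ x y : C, n (x * y) = n x * n y

attribute [instance] OctonionAlgebra.ringC OctonionAlgebra.modC OctonionAlgebra.sccC
  OctonionAlgebra.istC

namespace OctonionAlgebra

variable {F : Type u} [Field F] (O : OctonionAlgebra.{u, v} F)

/-- Conjugation `x̄ := n(x,1)•1 - x` (bundled as a linear map; `polarBilin n x 1 = n(x,1)`). -/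
def conj : O.C →ₗ[F] O.C :=
  (LinearMap.toSpanSingleton F O.C (1 : O.C)).comp ((QuadraticMap.polarBilin O.n).flip 1)
    - LinearMap.id

lemma conj_apply (x : O.C) :
    O.conj x = QuadraticMap.polar (⇑O.n) x 1 • (1 : O.C) - x := rfl

/-- A split octonion algebra: the norm form is isotropic. -/
def IsSplit : Prop := ∃ x : O.C, x ≠ 0 ∧ O.n x = 0

end OctonionAlgebra

/-- A reduced Albert algebra `H₃(C,γ)`. -/
structure ReducedAlbert (F : Type u) [Field F] : Type (max u (v + 1)) where
  O : OctonionAlgebra.{u, v} F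
  γ : Fin 3 → Fˣ

namespace ReducedAlbert

variable {F : Type u} [Field F] (A : ReducedAlbert.{u, v} F)

/-- The ambient space of 3×3 matrices over the octonion algebra. -/
abbrev M : Type v := Matrix (Fin 3) (Fin 3) A.O.C

/-- The 27-dimensional space `H₃(C,γ)` of `γ`-hermitian matrices:
`x = γ⁻¹ ⬝ (x̄)ᵀ ⬝ γ`, i.e. entrywise `x i j = γᵢ⁻¹ γⱼ • conj (x j i)`. -/
def J : Submodule F A.M where
  carrier := {x | ∀ i j, x i j = ((A.γ i : F)⁻¹ * (A.γ j : F)) • A.O.conj (x j i)}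
  add_mem' := by
    intro a b ha hb i j
    show a i j + b i j = ((A.γ i : F)⁻¹ * (A.γ j : F)) • A.O.conj (a j i + b j i)
    rw [map_add, smul_add, ← ha i j, ← hb i j]
  zero_mem' := by
    intro i j
    show (0 : A.O.C) = ((A.γ i : F)⁻¹ * (A.γ j : F)) • A.O.conj (0 : A.O.C)
    rw [map_zero, smul_zero]
  smul_mem' := by
    intro c a ha i j
    show c • a i j = ((A.γ i : F)⁻¹ * (A.γ j : F)) • A.O.conj (c • a j i)
    rw [map_smul, smul_comm, ← ha i j]

/-- The Jordan product `x·y := (xy + yx)/2`. -/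
def jmul (x y : A.M) : A.M := (2 : F)⁻¹ • (x * y + y * x)

/-- The trace `T(x)`: the sum of the diagonal entries, which for hermitian matrices are
scalars `ε•1`; the scalar `ε` is recovered as `n(ε•1, 1)/2`. -/
def trace (x : A.M) : F := (2 : F)⁻¹ * ∑ i, QuadraticMap.polar (⇑A.O.n) (x i i) 1

/-- The trace bilinear form `T(x,y) := T(x·y)`. -/
def tb (x y : A.M) : F := A.trace (A.jmul x y)

/-- The adjoint `x ^ # = x·x − T(x)·x + ½(T(x)² − T(x,x))·1`, the unique quadratic map such
that `T(x^#, y)` is the coefficient of `s` in `N(x + s y)`. -/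
def sharp (x : A.M) : A.M :=
  A.jmul x x - A.trace x • x + ((2 : F)⁻¹ * (A.trace x ^ 2 - A.tb x x)) • (1 : A.M)

/-- The Freudenthal cross product `x × y := (x+y)^# − x^# − y^#`. -/
def cross (x y : A.M) : A.M := A.sharp (x + y) - A.sharp x - A.sharp y

/-- The cubic norm `N`, defined pointwise on `J` by
`N(x)·1 = x·(x·x) − T(x)·(x·x) + ½(T(x)² − T(x,x))·x`; the scalar is recovered by
applying the trace (which takes value `3` on `1`). -/
def norm (x : A.M) : F :=
  (3 : F)⁻¹ * A.trace (A.jmul x (A.jmul x x) - A.trace x • A.jmul x x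
    + ((2 : F)⁻¹ * (A.trace x ^ 2 - A.tb x x)) • x)

/-- The operator `⟨x,y⟩(j) := ½ (y × (x × j) − T(j,y)·x − ⅓·T(x,y)·j)`. -/
def brok (x y j : A.M) : A.M :=
  (2 : F)⁻¹ • (A.cross y (A.cross x j) - A.tb j y • x - ((3 : F)⁻¹ * A.tb x y) • j)

/-- `A` is the split Albert algebra `H₃(Cᵈ, 1)`. -/
def IsSplitAlbert : Prop := A.O.IsSplit ∧ ∀ i, A.γ i = 1

/-- A point of `H₃(C,γ)` with coordinates `(ε₀,ε₁,ε₂; a,b,c)`. -/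
def elt (ε : Fin 3 → F) (a b c : A.O.C) : A.M :=
  Matrix.of
    ![![ε 0 • (1 : A.O.C), c, ((A.γ 0 : F)⁻¹ * (A.γ 2 : F)) • A.O.conj b],
      ![((A.γ 1 : F)⁻¹ * (A.γ 0 : F)) • A.O.conj c, ε 1 • (1 : A.O.C), a],
      ![b, ((A.γ 2 : F)⁻¹ * (A.γ 1 : F)) • A.O.conj a, ε 2 • (1 : A.O.C)]]

/-! ### The Brown algebra `B(J, F×F, ζ)` -/

/-- Ambient space of the Brown algebra `B(J, F×F, ζ)`: elements `(α, j; j', β)`. -/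
abbrev Bam : Type (max u v) := F × A.M × A.M × F

/-- The underlying 56-dimensional space of `B(J, F×F, ζ)`: both middle components lie in `J`. -/
def Bsub : Submodule F A.Bam where
  carrier := {p | p.2.1 ∈ A.J ∧ p.2.2.1 ∈ A.J}
  add_mem' := fun ha hb => ⟨A.J.add_mem ha.1 hb.1, A.J.add_mem ha.2 hb.2⟩
  zero_mem' := ⟨A.J.zero_mem, A.J.zero_mem⟩
  smul_mem' := fun c _ h => ⟨A.J.smul_mem c h.1, A.J.smul_mem c h.2⟩

/-- The product of `B(J, F×F, ζ)`. -/
def bmul (ζ : F) (x y : A.Bam) : A.Bam :=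
  (x.1 * y.1 + ζ * A.tb x.2.1 y.2.2.1,
   x.1 • y.2.1 + y.2.2.2 • x.2.1 + ζ • A.cross x.2.2.1 y.2.2.1,
   y.1 • x.2.2.1 + x.2.2.2 • y.2.2.1 + A.cross x.2.1 y.2.1,
   x.2.2.2 * y.2.2.2 + ζ * A.tb y.2.1 x.2.2.1)

/-- The involution `(α,j;j',β)‾ = (β,j;j',α)` of `B(J, F×F, ζ)`. -/
def binv (x : A.Bam) : A.Bam := (x.2.2.2, x.2.1, x.2.2.1, x.1)

/-- The skew-symmetric element `s₀ = (1,0;0,−1)`. -/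
def s0 : A.Bam := (1, 0, 0, -1)

/-- The triple product `{x,y,z} := (x·ȳ)·z + (z·ȳ)·x − (z·x̄)·y` in `B(J, F×F, ζ)`. -/
def brace (ζ : F) (x y z : A.Bam) : A.Bam :=
  A.bmul ζ (A.bmul ζ x (A.binv y)) z + A.bmul ζ (A.bmul ζ z (A.binv y)) x
    - A.bmul ζ (A.bmul ζ z (A.binv x)) y

/-- The bilinear form of the triple system associated to `B(J, F×F, ζ)` and a skew element
`s`: `b(x,y)` is the unique scalar with `b(x,y)•1 = (x·ȳ − y·x̄)·s`; since the unit of the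
algebra is `(1,0;0,1)`, it is the first component of the right-hand side. -/
def bformS (ζ : F) (s x y : A.Bam) : F :=
  (A.bmul ζ (A.bmul ζ x (A.binv y) - A.bmul ζ y (A.binv x)) s).1

/-- The trilinear product of the triple system associated to `B(J, F×F, ζ)` and `s`:
`t(y,z,w) := 2{y, s·z, w} − b(z,w)·y − b(z,y)·w − b(y,w)·z`. -/
def tformS (ζ : F) (s y z w : A.Bam) : A.Bam :=
  (2 : F) • A.brace ζ y (A.bmul ζ s z) w - A.bformS ζ s z w • y - A.bformS ζ s z y • w
    - A.bformS ζ s y w • z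

/-- The bilinear form of the triple system associated to `B(J, F×F, ζ)` and `s₀`. -/
def bform (ζ : F) (x y : A.Bam) : F := A.bformS ζ A.s0 x y

/-- The trilinear product of the triple system associated to `B(J, F×F, ζ)` and `s₀`. -/
def tform (ζ : F) (y z w : A.Bam) : A.Bam := A.tformS ζ A.s0 y z w

/-- `e` is a singular element of `B(J, F×F, ζ)`: `e ≠ 0` and `U_e(B) ⊆ F·e`
where `U_e(x) := {e,x,e}`. -/
def IsSingular (ζ : F) (e : A.Bam) : Prop :=
  e ≠ 0 ∧ ∀ x ∈ A.Bsub, ∃ c : F, A.brace ζ e x e = c • e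

/-- `I` is an inner ideal of `B(J, F×F, ζ)`: a subspace of `B` with `U_e(B) ⊆ I`
for all `e ∈ I`. -/
def IsInnerIdeal (ζ : F) (I : Submodule F A.Bam) : Prop :=
  I ≤ A.Bsub ∧ ∀ e ∈ I, ∀ x ∈ A.Bsub, A.brace ζ e x e ∈ I

end ReducedAlbert




namespace OctonionAlgebra

variable {F : Type u} [Field F] (O : OctonionAlgebra.{u, v} F)

/-- The polar form `n(x,y)` of the norm. -/
def B : LinearMap.BilinForm F O.C := QuadraticMap.polarBilin O.n

lemma B_apply (x y : O.C) : O.B x y = O.n (x + y) - O.n x - O.n y := rfl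

lemma polar_eq_B (x y : O.C) : QuadraticMap.polar (⇑O.n) x y = O.B x y := rfl

lemma B_comm (x y : O.C) : O.B x y = O.B y x := QuadraticMap.polar_comm _ x y

lemma n_add (x y : O.C) : O.n (x + y) = O.n x + O.n y + O.B x y := by
  rw [B_apply]; ring

lemma B_self (x : O.C) : O.B x x = 2 * O.n x := by
  rw [← polar_eq_B, QuadraticMap.polar_self, two_nsmul, two_mul]

lemma n_smul (r : F) (x : O.C) : O.n (r • x) = r * r * O.n x := by
  simpa using QuadraticMap.map_smul O.n r x

lemma ext_B {x y : O.C} (h : ∀ z, O.B x z = O.B y z) : x = y := by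
  rw [← sub_eq_zero]
  refine O.nondeg _ fun z ↦ ?_
  rw [polar_eq_B, map_sub, LinearMap.sub_apply, h, sub_self]

lemma B_mul_left (x y z : O.C) : O.B (x * y) (x * z) = O.n x * O.B y z := by
  rw [B_apply, B_apply, ← mul_add]; simp only [O.n_mul]; ring

lemma B_mul_right (x y z : O.C) : O.B (x * z) (y * z) = O.B x y * O.n z := by
  rw [B_apply, B_apply, ← add_mul]; simp only [O.n_mul]; ring

lemma B_mul_add_B_mul (x y z w : O.C) :
    O.B (x * y) (w * z) + O.B (x * z) (w * y) = O.B x w * O.B y z := by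
  have h := O.B_mul_left (x + w) y z
  simp only [add_mul, map_add, LinearMap.add_apply, B_mul_left, n_add] at h
  rw [O.B_comm (w * y)] at h
  linear_combination h

lemma conj_eq (x : O.C) : O.conj x = O.B x 1 • (1 : O.C) - x := rfl

lemma B_one_one : O.B 1 1 = 2 := by rw [B_self, O.n_one, mul_one]

@[simp] lemma conj_conj (x : O.C) : O.conj (O.conj x) = x := by
  simp only [conj_eq, map_sub, map_smul, B_one_one]
  module

lemma conj_one : O.conj 1 = 1 := by
  rw [conj_eq, B_one_one]; module

lemma B_mul_eq_left (x y z : O.C) : O.B (x * y) z = O.B y (O.conj x * z) := by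
  have h := O.B_mul_add_B_mul x y z 1
  rw [one_mul, one_mul] at h
  simp only [conj_eq, sub_mul, smul_mul_assoc, one_mul, map_sub, map_smul, smul_eq_mul]
  rw [O.B_comm y (x * z)]
  linear_combination h

lemma B_mul_eq_right (x y z : O.C) : O.B (x * y) z = O.B x (z * O.conj y) := by
  have h := O.B_mul_add_B_mul x y 1 z
  rw [mul_one, mul_one] at h
  simp only [conj_eq, mul_sub, mul_smul_comm, mul_one, map_sub, map_smul, smul_eq_mul]
  linear_combination h

lemma B_conj_left (x y : O.C) : O.B (O.conj x) y = O.B x (O.conj y) := by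
  simp only [conj_eq, map_sub, map_smul, LinearMap.sub_apply, LinearMap.smul_apply,
    smul_eq_mul]
  rw [O.B_comm 1 y]; ring

@[simp] lemma n_conj (x : O.C) : O.n (O.conj x) = O.n x := by
  rw [conj_eq, sub_eq_add_neg, n_add, n_smul, O.n_one, QuadraticMap.map_neg, map_neg, map_smul,
    LinearMap.smul_apply, O.B_comm 1 x, smul_eq_mul]
  ring

lemma conj_mul_mul (x y : O.C) : O.conj x * (x * y) = O.n x • y :=
  O.ext_B fun z ↦ by
    rw [B_mul_eq_left, conj_conj, B_mul_left, map_smul, LinearMap.smul_apply, smul_eq_mul]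

lemma mul_mul_conj (x y : O.C) : x * y * O.conj y = O.n y • x :=
  O.ext_B fun z ↦ by
    rw [B_mul_eq_right, conj_conj, B_mul_right, map_smul, LinearMap.smul_apply, smul_eq_mul,
      mul_comm]

lemma mul_conj_self (x : O.C) : x * O.conj x = O.n x • (1 : O.C) := by
  simpa using O.mul_mul_conj 1 x

lemma conj_mul_self (x : O.C) : O.conj x * x = O.n x • (1 : O.C) := by
  simpa using O.conj_mul_mul x 1

lemma conj_mul (x y : O.C) : O.conj (x * y) = O.conj y * O.conj x :=
  O.ext_B fun z ↦ by
    rw [B_conj_left, B_mul_eq_left, O.B_mul_eq_left _ _ z, conj_conj, O.B_comm (O.conj x) (y * z),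
      B_mul_eq_right]

/-- The middle Moufang identity, in terms of the norm. -/
lemma mul_mul_mul (a b c : O.C) :
    a * b * (c * a) = O.B a (O.conj (b * c)) • a - O.n a • O.conj (b * c) :=
  O.ext_B fun z ↦ by
    have h := O.B_mul_add_B_mul c a z (O.conj (a * b))
    have e1 : O.B c (O.conj (a * b)) = O.B a (O.conj (b * c)) := by
      rw [← B_conj_left, B_comm, B_mul_eq_right, conj_mul]
    have e2 : O.B (c * z) (O.conj (a * b) * a) = O.n a * O.B (O.conj (b * c)) z := by
      have e : O.conj (a * b) * a = O.n a • O.conj b := by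
        simpa [conj_mul] using O.mul_mul_conj (O.conj b) (O.conj a)
      rw [e, map_smul, smul_eq_mul, B_mul_eq_left, B_comm, conj_mul]
    rw [B_mul_eq_left, map_sub, LinearMap.sub_apply, map_smul, map_smul, LinearMap.smul_apply,
      LinearMap.smul_apply, smul_eq_mul, smul_eq_mul, ← e1, ← e2, ← h]
    ring

lemma B_conj_mul_rotate (a b c : O.C) : O.B b (O.conj (c * a)) = O.B a (O.conj (b * c)) := by
  rw [← B_conj_left, B_comm, B_mul_eq_left, ← conj_mul, B_comm]

/-- An off-diagonal coordinate of `(x^#)^# = N(x) x` in `H₃(C,γ)`. -/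
lemma adjoint_offdiag {g₀ g₁ g₂ : F} (hg : g₀ * g₁ * g₂ = 1) (e₀ e₁ e₂ : F) (a b c : O.C) :
    (g₁ * g₂) • O.conj (((g₂ * g₀) • O.conj (c * a) - e₁ • b)
        * ((g₀ * g₁) • O.conj (a * b) - e₂ • c))
      - (e₁ * e₂ - g₀ * O.n a) • ((g₁ * g₂) • O.conj (b * c) - e₀ • a)
      = (e₀ * e₁ * e₂ - g₀ * e₀ * O.n a - g₁ * e₁ * O.n b - g₂ * e₂ * O.n c
        + O.B a (O.conj (b * c))) • a := by
  have h1 : O.conj (O.conj (c * a) * O.conj (a * b))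
      = O.B a (O.conj (b * c)) • a - O.n a • O.conj (b * c) := by
    rw [O.conj_mul, conj_conj, conj_conj, mul_mul_mul]
  have h2 : O.conj (O.conj (c * a) * c) = O.n c • a := by
    rw [O.conj_mul, conj_conj, conj_mul_mul]
  have h3 : O.conj (b * O.conj (a * b)) = O.n b • a := by
    rw [O.conj_mul, conj_conj, mul_mul_conj]
  simp only [sub_mul, mul_sub, smul_mul_assoc, mul_smul_comm, map_sub, map_smul, h1, h2, h3]
  match_scalars
  · linear_combination (O.B a (O.conj (b * c)) * (g₀ * g₁ * g₂ + 1) - g₂ * e₂ * O.n c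
      - g₁ * e₁ * O.n b) * hg
  · linear_combination (-O.n a * g₁ * g₂ * g₀) * hg

/-- A diagonal coordinate of `(x^#)^# = N(x) x` in `H₃(C,γ)`. -/
lemma adjoint_diag {g₀ g₁ g₂ : F} (hg : g₀ * g₁ * g₂ = 1) (e₀ e₁ e₂ : F) (a b c : O.C) :
    (e₂ * e₀ - g₁ * O.n b) * (e₀ * e₁ - g₂ * O.n c)
      - g₀ * O.n ((g₁ * g₂) • O.conj (b * c) - e₀ • a)
      = (e₀ * e₁ * e₂ - g₀ * e₀ * O.n a - g₁ * e₁ * O.n b - g₂ * e₂ * O.n c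
        + O.B a (O.conj (b * c))) * e₀ := by
  rw [sub_eq_add_neg ((g₁ * g₂) • O.conj (b * c)), ← neg_smul, n_add, n_smul, n_smul, n_conj,
    O.n_mul, map_smul, map_smul, LinearMap.smul_apply, O.B_comm _ a, smul_eq_mul, smul_eq_mul]
  linear_combination (-g₁ * g₂ * O.n b * O.n c + e₀ * O.B a (O.conj (b * c))) * hg

end OctonionAlgebra

namespace ReducedAlbert

open OctonionAlgebra

variable {F : Type u} [Field F] (A : ReducedAlbert.{u, v} F)

/-- The ratio of diagonal parameters attached to the `i`-th off-diagonal coordinate. -/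
def ratio (i : Fin 3) : F := (A.γ (i + 2) : F)⁻¹ * (A.γ (i + 1) : F)

lemma ratio_zero : A.ratio 0 = (A.γ 2 : F)⁻¹ * (A.γ 1 : F) := rfl
lemma ratio_one : A.ratio 1 = (A.γ 0 : F)⁻¹ * (A.γ 2 : F) := rfl
lemma ratio_two : A.ratio 2 = (A.γ 1 : F)⁻¹ * (A.γ 0 : F) := rfl

lemma ratio_mul_ratio_mul_ratio : A.ratio 0 * A.ratio 1 * A.ratio 2 = 1 := by
  rw [ratio_zero, ratio_one, ratio_two]
  field_simp

lemma elt_mem_J (ε : Fin 3 → F) (a b c : A.O.C) : A.elt ε a b c ∈ A.J := by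
  intro i j
  fin_cases i <;> fin_cases j <;>
    simp [elt, smul_smul, conj_one] <;>
    match_scalars <;> field_simp

lemma exists_elt_eq (h2 : (2 : F) ≠ 0) {x : A.M} (hx : x ∈ A.J) :
    ∃ ε a b c, x = A.elt ε a b c := by
  have hx' : ∀ i j, x i j = ((A.γ i : F)⁻¹ * (A.γ j : F)) • A.O.conj (x j i) := hx
  have hd : ∀ i, x i i = ((2 : F)⁻¹ * A.O.B (x i i) 1) • (1 : A.O.C) := fun i ↦ by
    have h := hx' i i
    rw [inv_mul_cancel₀ (Units.ne_zero _), one_smul, conj_eq, eq_sub_iff_add_eq,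
      ← two_smul F] at h
    rw [mul_smul, ← h, smul_smul, inv_mul_cancel₀ h2, one_smul]
  refine ⟨fun i ↦ (2 : F)⁻¹ * A.O.B (x i i) 1, x 1 2, x 2 0, x 0 1, ?_⟩
  ext i j
  fin_cases i <;> fin_cases j
  · exact hd 0
  · rfl
  · exact hx' 0 2
  · exact hx' 1 0
  · exact hd 1
  · rfl
  · rfl
  · exact hx' 2 1
  · exact hd 2

lemma elt_add (ε ε' : Fin 3 → F) (a b c a' b' c' : A.O.C) :
    A.elt ε a b c + A.elt ε' a' b' c' = A.elt (ε + ε') (a + a') (b + b') (c + c') := by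
  ext i j
  fin_cases i <;> fin_cases j <;> simp [elt, add_smul]

lemma elt_sub (ε ε' : Fin 3 → F) (a b c a' b' c' : A.O.C) :
    A.elt ε a b c - A.elt ε' a' b' c' = A.elt (ε - ε') (a - a') (b - b') (c - c') := by
  ext i j
  fin_cases i <;> fin_cases j <;> simp [elt, sub_smul, smul_sub]

lemma smul_elt (r : F) (ε : Fin 3 → F) (a b c : A.O.C) :
    r • A.elt ε a b c = A.elt (r • ε) (r • a) (r • b) (r • c) := by
  ext i j
  fin_cases i <;> fin_cases j <;> simp [elt, smul_smul, mul_comm r]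

lemma elt_zero : A.elt 0 0 0 0 = 0 := by
  ext i j
  fin_cases i <;> fin_cases j <;> simp [elt]

lemma one_eq_elt : (1 : A.M) = A.elt 1 0 0 0 := by
  ext i j
  fin_cases i <;> fin_cases j <;> simp [elt]

lemma trace_elt (h2 : (2 : F) ≠ 0) (ε : Fin 3 → F) (a b c : A.O.C) :
    A.trace (A.elt ε a b c) = ε 0 + ε 1 + ε 2 := by
  simp [trace, elt, Fin.sum_univ_three, polar_eq_B, B_one_one]
  field_simp

lemma tb_elt (h2 : (2 : F) ≠ 0) (ε ε' : Fin 3 → F) (a b c a' b' c' : A.O.C) :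
    A.tb (A.elt ε a b c) (A.elt ε' a' b' c') = ε 0 * ε' 0 + ε 1 * ε' 1 + ε 2 * ε' 2
      + A.ratio 0 * A.O.B a a' + A.ratio 1 * A.O.B b b' + A.ratio 2 * A.O.B c c' := by
  have e1 : ∀ x y : A.O.C, A.O.B (x * A.O.conj y) 1 = A.O.B x y := fun x y ↦ by
    rw [B_mul_eq_right, one_mul, conj_conj]
  have e2 : ∀ x y : A.O.C, A.O.B (A.O.conj x * y) 1 = A.O.B x y := fun x y ↦ by
    rw [B_mul_eq_left, mul_one, conj_conj, B_comm]
  simp [tb, jmul, trace, elt, Fin.sum_univ_three, mul_smul_comm, polar_eq_B, B_one_one, e1, e2,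
    A.O.B_comm a' a, A.O.B_comm b' b, A.O.B_comm c' c, ratio_zero, ratio_one, ratio_two]
  field_simp
  ring

lemma sharp_elt (h2 : (2 : F) ≠ 0) (ε : Fin 3 → F) (a b c : A.O.C) :
    A.sharp (A.elt ε a b c) =
      A.elt ![ε 1 * ε 2 - A.ratio 0 * A.O.n a, ε 2 * ε 0 - A.ratio 1 * A.O.n b,
          ε 0 * ε 1 - A.ratio 2 * A.O.n c]
        ((A.ratio 1 * A.ratio 2) • A.O.conj (b * c) - ε 0 • a)
        ((A.ratio 2 * A.ratio 0) • A.O.conj (c * a) - ε 1 • b)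
        ((A.ratio 0 * A.ratio 1) • A.O.conj (a * b) - ε 2 • c) := by
  rw [sharp, tb_elt A h2, trace_elt A h2]
  ext i j
  fin_cases i <;> fin_cases j <;>
    simp [jmul, elt, mul_smul_comm, ratio_zero, ratio_one, ratio_two,
      A.O.conj_mul, mul_conj_self, conj_mul_self, B_self] <;>
    match_scalars <;> field_simp <;> ring

lemma sharp_sharp_elt (h2 : (2 : F) ≠ 0) (ε : Fin 3 → F) (a b c : A.O.C) :
    A.sharp (A.sharp (A.elt ε a b c)) =
      (ε 0 * ε 1 * ε 2 - A.ratio 0 * ε 0 * A.O.n a - A.ratio 1 * ε 1 * A.O.n b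
        - A.ratio 2 * ε 2 * A.O.n c + A.O.B a (A.O.conj (b * c))) • A.elt ε a b c := by
  have hg := A.ratio_mul_ratio_mul_ratio
  have hr := A.O.B_conj_mul_rotate
  have hg1 : A.ratio 1 * A.ratio 2 * A.ratio 0 = 1 := by linear_combination hg
  have hg2 : A.ratio 2 * A.ratio 0 * A.ratio 1 = 1 := by linear_combination hg
  have d0 := A.O.adjoint_diag hg (ε 0) (ε 1) (ε 2) a b c
  have d1 := A.O.adjoint_diag hg1 (ε 1) (ε 2) (ε 0) b c a
  have d2 := A.O.adjoint_diag hg2 (ε 2) (ε 0) (ε 1) c a b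
  have o0 := A.O.adjoint_offdiag hg (ε 0) (ε 1) (ε 2) a b c
  have o1 := A.O.adjoint_offdiag hg1 (ε 1) (ε 2) (ε 0) b c a
  have o2 := A.O.adjoint_offdiag hg2 (ε 2) (ε 0) (ε 1) c a b
  rw [hr a b c] at d1 o1
  rw [hr b c a, hr a b c] at d2 o2
  rw [sharp_elt A h2, sharp_elt A h2, smul_elt]
  congr 1
  · ext i
    fin_cases i
    · exact d0
    · refine d1.trans ?_
      change _ = _ * ε 1
      ring
    · refine d2.trans ?_
      change _ = _ * ε 2
      ring
  · refine o1.trans ?_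
    congr 1
    ring
  · refine o2.trans ?_
    congr 1
    ring

lemma sharp_mem_J (h2 : (2 : F) ≠ 0) {x : A.M} (hx : x ∈ A.J) : A.sharp x ∈ A.J := by
  obtain ⟨ε, a, b, c, rfl⟩ := A.exists_elt_eq h2 hx
  rw [sharp_elt A h2]
  exact A.elt_mem_J _ _ _ _

lemma cross_mem_J (h2 : (2 : F) ≠ 0) {x y : A.M} (hx : x ∈ A.J) (hy : y ∈ A.J) :
    A.cross x y ∈ A.J :=
  A.J.sub_mem (A.J.sub_mem (A.sharp_mem_J h2 (A.J.add_mem hx hy)) (A.sharp_mem_J h2 hx))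
    (A.sharp_mem_J h2 hy)

lemma jmul_comm (x y : A.M) : A.jmul x y = A.jmul y x := by
  rw [jmul, jmul, add_comm]

lemma jmul_add (x y z : A.M) : A.jmul x (y + z) = A.jmul x y + A.jmul x z := by
  rw [jmul, jmul, jmul, mul_add, add_mul]
  module

lemma jmul_smul (r : F) (x y : A.M) : A.jmul x (r • y) = r • A.jmul x y := by
  rw [jmul, jmul, mul_smul_comm, smul_mul_assoc]
  module

lemma trace_add (x y : A.M) : A.trace (x + y) = A.trace x + A.trace y := by
  simp only [trace, polar_eq_B, Matrix.add_apply, map_add, LinearMap.add_apply,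
    Finset.sum_add_distrib, mul_add]

lemma trace_smul (r : F) (x : A.M) : A.trace (r • x) = r * A.trace x := by
  simp only [trace, polar_eq_B, Matrix.smul_apply, map_smul, LinearMap.smul_apply, smul_eq_mul,
    ← Finset.mul_sum]
  ring

lemma tb_comm (x y : A.M) : A.tb x y = A.tb y x := by
  rw [tb, jmul_comm, tb]

lemma tb_add (x y z : A.M) : A.tb x (y + z) = A.tb x y + A.tb x z := by
  rw [tb, jmul_add, trace_add, tb, tb]

lemma tb_smul (r : F) (x y : A.M) : A.tb x (r • y) = r * A.tb x y := by
  rw [tb, jmul_smul, trace_smul, tb]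

lemma cross_comm (x y : A.M) : A.cross x y = A.cross y x := by
  rw [cross, cross, add_comm]
  abel

lemma cross_eq (h2 : (2 : F) ≠ 0) (x y : A.M) :
    A.cross x y = (2 : F) • A.jmul x y - A.trace x • y - A.trace y • x
      + (A.trace x * A.trace y - A.tb x y) • (1 : A.M) := by
  rw [cross, sharp, sharp, sharp, jmul_add, A.jmul_comm (x + y) x, A.jmul_comm (x + y) y,
    jmul_add, jmul_add, A.jmul_comm y x, tb_add, A.tb_comm (x + y) x, A.tb_comm (x + y) y,
    tb_add, tb_add, A.tb_comm y x, trace_add]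
  match_scalars <;> field_simp <;> ring

lemma cross_self (h2 : (2 : F) ≠ 0) (x : A.M) : A.cross x x = (2 : F) • A.sharp x := by
  rw [cross_eq A h2, sharp]
  match_scalars <;> field_simp
  ring

lemma cross_add (h2 : (2 : F) ≠ 0) (x y z : A.M) :
    A.cross x (y + z) = A.cross x y + A.cross x z := by
  simp only [cross_eq A h2, jmul_add, trace_add, tb_add]
  module

lemma cross_smul (h2 : (2 : F) ≠ 0) (r : F) (x y : A.M) :
    A.cross x (r • y) = r • A.cross x y := by
  simp only [cross_eq A h2, jmul_smul, trace_smul, tb_smul]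
  module

lemma jmul_one_left (h2 : (2 : F) ≠ 0) (x : A.M) : A.jmul 1 x = x := by
  rw [jmul, one_mul, mul_one, ← two_smul F, smul_smul, inv_mul_cancel₀ h2, one_smul]

lemma trace_one (h2 : (2 : F) ≠ 0) : A.trace 1 = 3 := by
  rw [one_eq_elt, trace_elt A h2]
  norm_num

lemma cross_one_left (h2 : (2 : F) ≠ 0) (x : A.M) : A.cross 1 x = A.trace x • 1 - x := by
  rw [cross_eq A h2, tb, jmul_one_left A h2, trace_one A h2]
  module

/-- The cross product as a bilinear map on `J`. -/
def crossJ (h2 : (2 : F) ≠ 0) : A.J →ₗ[F] A.J →ₗ[F] A.J :=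
  LinearMap.mk₂ F (fun x y ↦ ⟨A.cross x y, A.cross_mem_J h2 x.2 y.2⟩)
    (fun x y z ↦ Subtype.ext <| by
      simpa only [Submodule.coe_add, A.cross_comm _ z] using A.cross_add h2 z x y)
    (fun r x y ↦ Subtype.ext <| by
      simpa only [Submodule.coe_smul, A.cross_comm _ y] using A.cross_smul h2 r y x)
    (fun x y z ↦ Subtype.ext <| A.cross_add h2 x y z)
    (fun r x y ↦ Subtype.ext <| A.cross_smul h2 r x y)

/-- The trace form as a bilinear form on `J`. -/
def tbJ : A.J →ₗ[F] A.J →ₗ[F] F :=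
  LinearMap.mk₂ F (fun x y ↦ A.tb x y)
    (fun x y z ↦ by
      simpa only [Submodule.coe_add, A.tb_comm _ z] using A.tb_add z x y)
    (fun r x y ↦ by
      simpa only [Submodule.coe_smul, A.tb_comm _ y, smul_eq_mul] using A.tb_smul r y x)
    (fun x y z ↦ A.tb_add x y z)
    (fun r x y ↦ A.tb_smul r x y)

lemma tb_cross_rotate (h2 : (2 : F) ≠ 0) {x y z : A.M} (hx : x ∈ A.J) (hy : y ∈ A.J)
    (hz : z ∈ A.J) : A.tb (A.cross x y) z = A.tb (A.cross y z) x := by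
  obtain ⟨ε, a, b, c, rfl⟩ := A.exists_elt_eq h2 hx
  obtain ⟨ε', a', b', c', rfl⟩ := A.exists_elt_eq h2 hy
  obtain ⟨ε'', a'', b'', c'', rfl⟩ := A.exists_elt_eq h2 hz
  have hb : ∀ a b c, A.O.B (A.O.conj (c * a)) b = A.O.B (A.O.conj (b * c)) a := fun a b c ↦ by
    rw [B_comm, B_conj_mul_rotate, B_comm]
  have hc : ∀ a b c, A.O.B (A.O.conj (a * b)) c = A.O.B (A.O.conj (b * c)) a := fun a b c ↦
    (hb b c a).trans (hb a b c)
  simp only [cross, elt_add, sharp_elt A h2, elt_sub, tb_elt A h2]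
  simp only [Pi.add_apply, Pi.sub_apply, Matrix.cons_val, n_add, add_mul, mul_add, add_smul,
    smul_add, map_add, map_sub, map_smul, LinearMap.add_apply, LinearMap.sub_apply,
    LinearMap.smul_apply, smul_eq_mul,
    hb a' b'' c, hb a b'' c', hb a' b c'', hb a'' b c', hc a b' c'', hc a' b c'', hc a' b'' c,
    hc a'' b' c, A.O.B_comm a' a, A.O.B_comm a'' a, A.O.B_comm b' b, A.O.B_comm b'' b,
    A.O.B_comm c' c, A.O.B_comm c'' c]
  ring

lemma tb_nondegenerate (h2 : (2 : F) ≠ 0) {x : A.M} (hx : x ∈ A.J)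
    (h : ∀ y ∈ A.J, A.tb x y = 0) : x = 0 := by
  obtain ⟨ε, a, b, c, rfl⟩ := A.exists_elt_eq h2 hx
  have ht := fun ε' a' b' c' ↦ h _ (A.elt_mem_J ε' a' b' c')
  simp only [tb_elt A h2] at ht
  have hr : ∀ i, A.ratio i ≠ 0 := fun i ↦
    mul_ne_zero (inv_ne_zero (Units.ne_zero _)) (Units.ne_zero _)
  have hε : ε = 0 := by
    ext i
    have := ht (Pi.single i 1) 0 0 0
    fin_cases i <;> simpa [Pi.single_apply] using this
  have ha : a = 0 := A.O.nondeg a fun z ↦ by simpa [hr, polar_eq_B] using ht 0 z 0 0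
  have hb : b = 0 := A.O.nondeg b fun z ↦ by simpa [hr, polar_eq_B] using ht 0 0 z 0
  have hc : c = 0 := A.O.nondeg c fun z ↦ by simpa [hr, polar_eq_B] using ht 0 0 0 z
  rw [hε, ha, hb, hc, elt_zero]

lemma sharp_sharp (h2 : (2 : F) ≠ 0) {x : A.M} (hx : x ∈ A.J) :
    (3 : F) • A.sharp (A.sharp x) = A.tb (A.sharp x) x • x := by
  obtain ⟨ε, a, b, c, rfl⟩ := A.exists_elt_eq h2 hx
  rw [sharp_sharp_elt A h2, smul_smul, sharp_elt A h2, tb_elt A h2]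
  have hb : A.O.B (A.O.conj (c * a)) b = A.O.B a (A.O.conj (b * c)) := by
    rw [B_comm, B_conj_mul_rotate]
  have hc : A.O.B (A.O.conj (a * b)) c = A.O.B a (A.O.conj (b * c)) := by
    rw [B_comm, B_conj_mul_rotate, B_conj_mul_rotate]
  congr 1
  simp only [Matrix.cons_val, map_sub, map_smul, LinearMap.sub_apply, LinearMap.smul_apply,
    smul_eq_mul, B_self, hb, hc, A.O.B_comm _ a]
  linear_combination (-3 * A.O.B a (A.O.conj (b * c))) * A.ratio_mul_ratio_mul_ratio

lemma cross_cross_self (h2 : (2 : F) ≠ 0) {x : A.M} (hx : x ∈ A.J) :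
    (3 : F) • A.cross (A.cross x x) (A.cross x x) = (4 * A.tb (A.cross x x) x) • x := by
  have h := A.sharp_sharp h2 hx
  simp only [A.cross_self h2 x, cross_smul A h2, A.cross_comm ((2 : F) • _), A.cross_self h2,
    A.tb_comm ((2 : F) • _) x, tb_smul]
  rw [A.tb_comm x]
  linear_combination (norm := module) (8 : F) • h

end ReducedAlbert

section CubicNorm

variable {F : Type u} [Field F] {V : Type v} [AddCommGroup V] [Module F V]
  {cr : V →ₗ[F] V →ₗ[F] V} {T : V →ₗ[F] V →ₗ[F] F}

/-- First linearization of the adjoint identity `(x^#)^# = N(x) x`, where `cr x x = 2 x^#`. -/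
lemma adjoint_linearized (h2 : (2 : F) ≠ 0) (h3 : (3 : F) ≠ 0)
    (hcomm : ∀ x y, cr x y = cr y x)
    (htri : ∀ x y z, T (cr x y) z = T (cr y z) x)
    (hadj : ∀ x, (3 : F) • cr (cr x x) (cr x x) = (4 * T (cr x x) x) • x) (x y : V) :
    (3 : F) • cr (cr x x) (cr x y) = (3 * T (cr x x) y) • x + T (cr x x) x • y := by
  have h1 := hadj (x + y)
  have hm := hadj (x + (-1 : F) • y)
  have hd := hadj (x + (2 : F) • y)
  have h0 := hadj x
  have hy := hadj y
  have e1 : T (cr x y) x = T (cr x x) y := by rw [hcomm x y, htri y x x]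
  have e2 : T (cr x y) y = T (cr y y) x := htri x y y
  simp only [map_add, map_smul, LinearMap.add_apply, LinearMap.smul_apply, smul_eq_mul,
    hcomm y x, hcomm (cr y y), hcomm (cr x y) (cr x x), e1, e2] at h1 hm hd
  have h24 : (24 : F) ≠ 0 := by
    rw [show (24 : F) = 2 * 2 * 2 * 3 by norm_num]
    exact mul_ne_zero (mul_ne_zero (mul_ne_zero h2 h2) h2) h3
  refine smul_right_injective V h24 ?_
  dsimp only
  linear_combination (norm := module) (6 : F) • h1 - (2 : F) • hm - hd - (3 : F) • h0 + (12 : F) • hy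

lemma cross_cross_of_sharp_eq_zero (h2 : (2 : F) ≠ 0) (h3 : (3 : F) ≠ 0)
    (hcomm : ∀ x y, cr x y = cr y x)
    (htri : ∀ x y z, T (cr x y) z = T (cr y z) x)
    (hadj : ∀ x, (3 : F) • cr (cr x x) (cr x x) = (4 * T (cr x x) x) • x) {x : V}
    (hx : cr x x = 0) (y z : V) :
    cr (cr x y) (cr x z) = T (cr x y) z • x := by
  have key := adjoint_linearized h2 h3 hcomm htri hadj
  have h1 := key (x + y) z
  have hm := key (x - y) z
  have hy := key y z
  have e1 : T (cr x y) x = 0 := by rw [hcomm x y, htri y x x, hx]; simp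
  simp only [map_add, map_sub, LinearMap.add_apply, LinearMap.sub_apply,
    hcomm y x, hx, e1, map_zero, LinearMap.zero_apply] at h1 hm
  refine smul_right_injective V (mul_ne_zero (mul_ne_zero h2 h2) h3) ?_
  dsimp only
  linear_combination (norm := module) h1 - hm - (2 : F) • hy

/-- If `x^# = 0` and `y = x × k`, then `⟨x,y⟩ = 0`. -/
lemma brok_eq_zero_of_mem_cross (h2 : (2 : F) ≠ 0) (h3 : (3 : F) ≠ 0)
    (hcomm : ∀ x y, cr x y = cr y x) (hT : ∀ x y, T x y = T y x)
    (htri : ∀ x y z, T (cr x y) z = T (cr y z) x)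
    (hadj : ∀ x, (3 : F) • cr (cr x x) (cr x x) = (4 * T (cr x x) x) • x) {x : V}
    (hx : cr x x = 0) (k z : V) :
    cr (cr x k) (cr x z) - T z (cr x k) • x - ((3 : F)⁻¹ * T x (cr x k)) • z = 0 := by
  have e : T x (cr x k) = 0 := by rw [hT, hcomm, htri, hx]; simp
  rw [cross_cross_of_sharp_eq_zero h2 h3 hcomm htri hadj hx, e, hT z]
  simp

lemma mem_cross_of_brok_eq_zero (h2 : (2 : F) ≠ 0) (h3 : (3 : F) ≠ 0)
    (hcomm : ∀ x y, cr x y = cr y x) (hT : ∀ x y, T x y = T y x)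
    (htri : ∀ x y z, T (cr x y) z = T (cr y z) x)
    (hnd : ∀ x, (∀ y, T x y = 0) → x = 0) {x y : V} (hx0 : x ≠ 0) (hx : cr x x = 0)
    (h : ∀ z, cr y (cr x z) - T z y • x - ((3 : F)⁻¹ * T x y) • z = 0) :
    ∃ k, y = cr x k := by
  have ht : T x y = 0 := by
    have h1 := h x
    rw [hx, map_zero, zero_sub, sub_eq_zero, neg_eq_iff_add_eq_zero, ← add_smul] at h1
    have h4 := (smul_eq_zero.mp h1).resolve_right hx0
    field_simp at h4
    have : (2 : F) * 2 * T x y = 0 := by linear_combination h4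
    simpa [h2] using this
  obtain ⟨w, hw⟩ : ∃ w, T x w ≠ 0 := by
    by_contra! hcon
    exact hx0 (hnd x hcon)
  refine ⟨(T x w)⁻¹ • cr y w, ?_⟩
  rw [map_smul, eq_inv_smul_iff₀ hw, ← sub_eq_zero]
  refine hnd _ fun z ↦ ?_
  have h1 := congrArg (fun v ↦ T v w) (h z)
  have e : T (cr y (cr x z)) w = T (cr x (cr y w)) z := by
    rw [hcomm y, htri (cr x z), hT, htri x z, hT, htri x, hcomm, hT]
  simp only [ht, map_sub, map_smul, LinearMap.sub_apply, LinearMap.smul_apply, e, map_zero,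
    LinearMap.zero_apply, smul_eq_mul] at h1 ⊢
  rw [hT y z]
  linear_combination -h1

lemma sharp_mul_brok (h2 : (2 : F) ≠ 0) (h3 : (3 : F) ≠ 0)
    (hcomm : ∀ x y, cr x y = cr y x) (hT : ∀ x y, T x y = T y x)
    (htri : ∀ x y z, T (cr x y) z = T (cr y z) x)
    (hadj : ∀ x, (3 : F) • cr (cr x x) (cr x x) = (4 * T (cr x x) x) • x) {x y : V}
    (z : V) {c : F}
    (h : cr y (cr x z) - T z y • x - ((3 : F)⁻¹ * T x y) • z = c • x) :
    c * T (cr z z) x = 0 := by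
  have h1 := congrArg (fun v ↦ T v y) (adjoint_linearized h2 h3 hcomm htri hadj z x)
  have h0 := congrArg (fun v ↦ T v (cr z z)) h
  have e : T (cr (cr z z) (cr z x)) y = T (cr y (cr x z)) (cr z z) := by
    rw [htri, hcomm (cr z x), hcomm z x]
  simp only [map_sub, map_add, map_smul, LinearMap.sub_apply, LinearMap.add_apply,
    LinearMap.smul_apply, smul_eq_mul, e, hT _ (cr z z)] at h1 h0
  refine (mul_eq_zero.mp ?_).resolve_left h3
  field_simp at h0
  linear_combination h1 - h0

/-- If the image of `⟨x,y⟩` lies in `F x` and some `T(z^#,x)` is nonzero, then `⟨x,y⟩ = 0`. -/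
lemma brok_eq_zero_of_range_le (h2 : (2 : F) ≠ 0) (h3 : (3 : F) ≠ 0)
    (hcomm : ∀ x y, cr x y = cr y x) (hT : ∀ x y, T x y = T y x)
    (htri : ∀ x y z, T (cr x y) z = T (cr y z) x)
    (hadj : ∀ x, (3 : F) • cr (cr x x) (cr x x) = (4 * T (cr x x) x) • x) {x y : V}
    (hx : ∃ z, T (cr z z) x ≠ 0)
    (h : ∀ z, ∃ c : F, cr y (cr x z) - T z y • x - ((3 : F)⁻¹ * T x y) • z = c • x) (z : V) :
    cr y (cr x z) - T z y • x - ((3 : F)⁻¹ * T x y) • z = 0 := by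
  let L : V → V := fun z ↦ cr y (cr x z) - T z y • x - ((3 : F)⁻¹ * T x y) • z
  have hL : ∀ z, T (cr z z) x • L z = 0 := fun z ↦ by
    obtain ⟨c, hc⟩ := h z
    have := sharp_mul_brok h2 h3 hcomm hT htri hadj z hc
    rw [show L z = c • x from hc, smul_smul, mul_comm, this, zero_smul]
  change L z = 0
  obtain ⟨w, hw⟩ := hx
  have hLw : L w = 0 := (smul_eq_zero.mp (hL w)).resolve_left hw
  have hadd : ∀ s : F, L (z + s • w) = L z := fun s ↦ by
    trans L z + s • L w
    · simp only [L, map_add, map_smul, LinearMap.add_apply, LinearMap.smul_apply, smul_eq_mul]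
      module
    · rw [hLw, smul_zero, add_zero]
  by_contra hz
  have hq : ∀ s : F, T (cr (z + s • w) (z + s • w)) x = 0 := fun s ↦
    (smul_eq_zero.mp (hadd s ▸ hL (z + s • w))).resolve_right hz
  have q0 := hq 0
  have q1 := hq 1
  have qm := hq (-1)
  simp only [map_add, map_smul, LinearMap.add_apply, LinearMap.smul_apply, smul_eq_mul,
    hcomm w z] at q0 q1 qm
  exact hw ((mul_eq_zero.mp (by linear_combination q1 + qm - 2 * q0 :
    (2 : F) * T (cr w w) x = 0)).resolve_left h2)

/-- In the presence of a base point `e`, no nonzero `x` is orthogonal to every `z^#`. -/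
lemma exists_trace_sharp_ne_zero (h2 : (2 : F) ≠ 0)
    (hcomm : ∀ x y, cr x y = cr y x) (hT : ∀ x y, T x y = T y x)
    (hnd : ∀ x, (∀ y, T x y = 0) → x = 0) {e : V} (he : T e e = 3)
    (hcr : ∀ x, cr e x = T e x • e - x) {x : V} (hx0 : x ≠ 0) : ∃ z, T (cr z z) x ≠ 0 := by
  by_contra! hcon
  have hlin : ∀ z, T (cr e z) x = 0 := fun z ↦ by
    have h1 := hcon (e + z)
    simp only [map_add, LinearMap.add_apply, hcon, hcomm z e] at h1
    refine (mul_eq_zero.mp ?_).resolve_left h2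
    linear_combination h1
  simp only [hcr, map_sub, map_smul, LinearMap.sub_apply, LinearMap.smul_apply,
    smul_eq_mul] at hlin
  have hex : T e x = 0 := by
    have h1 := hlin e
    rw [he] at h1
    refine (mul_eq_zero.mp ?_).resolve_left h2
    linear_combination h1
  refine hx0 (hnd x fun z ↦ ?_)
  have := hlin z
  rw [hT]
  linear_combination T e z * hex - this

end CubicNorm

/-- For `j, j' ∈ J` with `j ≠ 0` and `j^# = (j')^# = 0`, the following are
equivalent: (1) `j' ∈ j × J`; (2) `⟨j,j'⟩ = 0` in `End_F(J)`; (3) the image of `⟨j,j'⟩` is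
contained in `F·j`. -/
theorem stmt8 {F : Type u} [Field F] (h2 : (2 : F) ≠ 0) (h3 : (3 : F) ≠ 0)
    (A : ReducedAlbert.{u, v} F) (j j' : A.M) (hj : j ∈ A.J) (hj' : j' ∈ A.J)
    (hj0 : j ≠ 0) (hsharp : A.sharp j = 0) (hsharp' : A.sharp j' = 0) :
    ((∃ k ∈ A.J, j' = A.cross j k) ↔ (∀ z ∈ A.J, A.brok j j' z = 0)) ∧
    ((∀ z ∈ A.J, A.brok j j' z = 0) ↔ (∀ z ∈ A.J, ∃ c : F, A.brok j j' z = c • j)) := by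
  have hcomm : ∀ x y, A.crossJ h2 x y = A.crossJ h2 y x := fun x y ↦
    Subtype.ext (A.cross_comm x y)
  have hT : ∀ x y, A.tbJ x y = A.tbJ y x := fun x y ↦ A.tb_comm x y
  have htri : ∀ x y z, A.tbJ (A.crossJ h2 x y) z = A.tbJ (A.crossJ h2 y z) x := fun x y z ↦
    A.tb_cross_rotate h2 x.2 y.2 z.2
  have hadj : ∀ x, (3 : F) • A.crossJ h2 (A.crossJ h2 x x) (A.crossJ h2 x x)
      = (4 * A.tbJ (A.crossJ h2 x x) x) • x := fun x ↦
    Subtype.ext (A.cross_cross_self h2 x.2)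
  have hnd : ∀ x, (∀ y, A.tbJ x y = 0) → x = 0 := fun x hx ↦
    Subtype.ext (A.tb_nondegenerate h2 x.2 fun y hy ↦ hx ⟨y, hy⟩)
  let e : A.J := ⟨1, A.one_eq_elt ▸ A.elt_mem_J _ _ _ _⟩
  have htr : ∀ x, A.tbJ e x = A.trace x := fun x ↦ by
    change A.trace (A.jmul 1 x) = _
    rw [A.jmul_one_left h2]
  have he : A.tbJ e e = 3 := by
    rw [htr]
    exact A.trace_one h2
  have hcr : ∀ x, A.crossJ h2 e x = A.tbJ e x • e - x := fun x ↦ by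
    rw [htr]
    exact Subtype.ext (A.cross_one_left h2 x)
  let x : A.J := ⟨j, hj⟩
  let y : A.J := ⟨j', hj'⟩
  have hx0 : x ≠ 0 := fun h ↦ hj0 (congrArg Subtype.val h)
  have hx : A.crossJ h2 x x = 0 := Subtype.ext <| by
    change A.cross j j = 0
    rw [A.cross_self h2, hsharp, smul_zero]
  have hi : (2 : F)⁻¹ ≠ 0 := inv_ne_zero h2
  let L : A.J → A.J := fun z ↦
    A.crossJ h2 y (A.crossJ h2 x z) - A.tbJ z y • x - ((3 : F)⁻¹ * A.tbJ x y) • z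
  have hbrok : ∀ z : A.J, A.brok j j' z = (2 : F)⁻¹ • (L z : A.M) := fun z ↦ rfl
  have hbrok0 : (∀ z ∈ A.J, A.brok j j' z = 0) ↔ ∀ z, L z = 0 :=
    ⟨fun h z ↦ Subtype.ext ((smul_eq_zero.mp ((hbrok z).symm.trans (h z z.2))).resolve_left hi),
      fun h z hz ↦ by rw [hbrok ⟨z, hz⟩, h, Submodule.coe_zero, smul_zero]⟩
  refine ⟨⟨?_, ?_⟩, ⟨fun h z hz ↦ ⟨0, by rw [h z hz, zero_smul]⟩, ?_⟩⟩ <;> rw [hbrok0]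
  · rintro ⟨k, hk, h⟩
    have h' : y = A.crossJ h2 x ⟨k, hk⟩ := Subtype.ext h
    intro z
    simp only [L, h']
    exact brok_eq_zero_of_mem_cross h2 h3 hcomm hT htri hadj hx _ z
  · intro h
    obtain ⟨k, hk⟩ := mem_cross_of_brok_eq_zero h2 h3 hcomm hT htri hnd hx0 hx h
    exact ⟨k, k.2, congrArg Subtype.val hk⟩
  · intro h
    refine brok_eq_zero_of_range_le h2 h3 hcomm hT htri hadj
      (exists_trace_sharp_ne_zero h2 hcomm hT hnd he hcr hx0) fun z ↦ ?_
    obtain ⟨c, hc⟩ := h z z.2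
    refine ⟨2 * c, Subtype.ext ?_⟩
    change (L z : A.M) = (2 * c) • j
    rw [mul_smul, ← hc, hbrok, smul_smul, mul_inv_cancel₀ h2, one_smul]
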